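/- arXiv:2409.18488 — 2 statements merged into one kernel-verified Lean document; each statement's English description precedes it below -/
import Mathlib

section
/- Let B = diag(B^{(1)},...,B^{(ℓ)}) ∈ F_q^{t×n} be a block-diagonal support basis with rank profile (t_1,...,t_ℓ), t = t_1+...+t_ℓ ≤ n. Let H_E ∈ F_{q^m}^{(n−t)×n} satisfy rank_{q^m}(H_E) = n−t and B·H_Eᵀ = 0 (over F_{q^m}). Then for every i ∈ {1,...,ℓ}, the F_q-solution space {x ∈ F_q^{n_i} : H_E^{(i)}·x = 0 over F_{q^m}} equals the F_q-row space of B^{(i)}; in particular this solution space has F_q-dimension t_i. -/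
open Matrix

/-- If the rows of `B` (which has a right inverse `C`) lie in the kernel of `H` and their number is
complementary to the rank of `H`, then `C * B` acts as the identity on the kernel of `H`. -/
theorem Matrix.vecMul_mul_eq_self_of_mulVec_eq_zero {K r s n : Type*} [Field K] [Fintype r]
    [DecidableEq r] [Fintype s] [Fintype n] {B : Matrix r n K} {C : Matrix n r K}
    {H : Matrix s n K} (hBC : B * C = 1) (hrank : H.rank + Fintype.card r = Fintype.card n)
    (hBH : B * Hᵀ = 0) {v : n → K} (hv : H *ᵥ v = 0) : v ᵥ* (C * B) = v := by
  have hinj : Function.Injective B.vecMulLinear := by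
    refine Function.LeftInverse.injective (g := fun w => w ᵥ* C) fun y => ?_
    simp [Matrix.vecMul_vecMul, hBC]
  have hle : LinearMap.range B.vecMulLinear ≤ LinearMap.ker H.mulVecLin := by
    rintro _ ⟨y, rfl⟩
    simp [← Matrix.vecMul_transpose, Matrix.vecMul_vecMul, hBH]
  have heq : LinearMap.range B.vecMulLinear = LinearMap.ker H.mulVecLin := by
    refine Submodule.eq_of_le_of_finrank_eq hle ?_
    have h1 := LinearMap.finrank_range_of_inj hinj
    have h2 := H.mulVecLin.finrank_range_add_finrank_ker
    rw [Module.finrank_fintype_fun_eq_card] at h1 h2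
    change H.rank + _ = _ at h2
    omega
  have hmem : v ∈ LinearMap.range B.vecMulLinear := by
    rw [heq]
    simpa using hv
  obtain ⟨y, rfl⟩ := hmem
  rw [Matrix.vecMulLinear_apply, Matrix.vecMul_vecMul, ← Matrix.mul_assoc, hBC, Matrix.one_mul]

theorem Matrix.exists_mul_eq_one_of_rank_eq_card {F r n : Type*} [Field F] [Fintype r]
    [DecidableEq r] [Fintype n] {B : Matrix r n F} (h : B.rank = Fintype.card r) :
    ∃ C : Matrix n r F, B * C = 1 := by
  classical
  rw [← Matrix.mulVec_surjective_iff_exists_right_inverse]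
  have : LinearMap.range B.mulVecLin = ⊤ := by
    refine Submodule.eq_top_of_finrank_eq ?_
    rw [Module.finrank_fintype_fun_eq_card]
    exact h
  exact LinearMap.range_eq_top.mp this

/-- If `B = diag(B⁽¹⁾,…,B⁽ˡ⁾)` is a block-diagonal support basis with rank
profile `(t₁,…,t_ℓ)`, `t = t₁+⋯+t_ℓ ≤ n`, and `H_E ∈ F_{q^m}^{(n−t)×n}` has rank `n − t`
and satisfies `B·H_Eᵀ = 0`, then for every block `i` the `F_q`-solution space
`{x ∈ F_q^{n_i} : H_E⁽ⁱ⁾·x = 0}` equals the `F_q`-row space of `B⁽ⁱ⁾`. -/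
theorem stmt2 (q m n t ℓ : ℕ) (Fq K : Type) [Field Fq] [Fintype Fq] [Field K] [Fintype K]
    [Algebra Fq K]
    (hq : Fintype.card Fq = q) (hK : Fintype.card K = q ^ m)
    (hm : 1 ≤ m) (hl : 1 ≤ ℓ)
    (nn : Fin ℓ → ℕ) (hnn : ∀ i, 1 ≤ nn i) (hn : n = ∑ i, nn i)
    (tt : Fin ℓ → ℕ) (htdef : t = ∑ i, tt i) (htn : t ≤ n)
    (Bb : ∀ i, Matrix (Fin (tt i)) (Fin (nn i)) Fq)
    (hBrank : ∀ i, (Bb i).rank = tt i)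
    (HE : Matrix (Fin (n - t)) ((i : Fin ℓ) × Fin (nn i)) K)
    (hHErank : HE.rank = n - t)
    (hBHE : ((Matrix.blockDiagonal' Bb).map (algebraMap Fq K)) * HEᵀ = 0) :
    ∀ i : Fin ℓ,
      {x : Fin (nn i) → Fq |
          (Matrix.of fun (r : Fin (n - t)) (j : Fin (nn i)) => HE r ⟨i, j⟩) *ᵥ
              (fun j => algebraMap Fq K (x j)) = 0}
        = ↑(Submodule.span Fq (Set.range (Bb i))) := by
  intro i
  ext x
  simp only [Set.mem_ofPred_eq, SetLike.mem_coe]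
  constructor
  · intro hx
    choose C hC using fun i => Matrix.exists_mul_eq_one_of_rank_eq_card
      ((hBrank i).trans (Fintype.card_fin _).symm)
    let e : ((i : Fin ℓ) × Fin (nn i)) → Fq := fun p => (Pi.single i x : ∀ k, Fin (nn k) → Fq) p.1 p.2
    have hBC : (blockDiagonal' Bb).map (algebraMap Fq K) *
        (blockDiagonal' C).map (algebraMap Fq K) = 1 := by
      rw [← Matrix.map_mul, ← blockDiagonal'_mul, funext hC]
      have h1 : blockDiagonal' (fun k => (1 : Matrix (Fin (tt k)) (Fin (tt k)) Fq)) = 1 :=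
        blockDiagonal'_one
      rw [h1, Matrix.map_one _ (map_zero _) (map_one _)]
    have hker : HE *ᵥ (algebraMap Fq K ∘ e) = 0 := by
      rw [← hx]
      ext r
      simp only [Matrix.mulVec, dotProduct, Fintype.sum_sigma, Function.comp_apply, of_apply]
      rw [Finset.sum_eq_single i (fun k _ hk => by simp [e, Pi.single_eq_of_ne hk]) (by simp)]
      simp [e]
    have hfix := Matrix.vecMul_mul_eq_self_of_mulVec_eq_zero hBC
      (by simp only [hHErank, Fintype.card_sigma, Fintype.card_fin]; omega) hBHE hker
    have hfix' : x = (x ᵥ* C i) ᵥ* Bb i := by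
      ext j
      have hj := congrFun hfix ⟨i, j⟩
      rw [← Matrix.map_mul, ← blockDiagonal'_mul, ← RingHom.map_vecMul] at hj
      have hj' := (algebraMap Fq K).injective hj
      simp only [Matrix.vecMul, dotProduct, Fintype.sum_sigma] at hj'
      rw [Finset.sum_eq_single i (fun k _ hk => by simp [e, Pi.single_eq_of_ne hk])
        (by simp)] at hj'
      rw [Matrix.vecMul_vecMul]
      simpa [e, Matrix.vecMul, dotProduct, blockDiagonal'_apply_eq] using hj'.symm
    rw [hfix']
    change _ ∈ Submodule.span Fq (Set.range (Bb i).row)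
    rw [← range_vecMulLinear]
    exact ⟨_, rfl⟩
  · intro hx
    induction hx using Submodule.span_induction with
    | mem x hx =>
      obtain ⟨k, rfl⟩ := hx
      ext r
      have h := congrFun (congrFun hBHE ⟨i, k⟩) r
      simp only [Matrix.mul_apply, Fintype.sum_sigma] at h
      rw [Finset.sum_eq_single i
        (fun k _ hk => by simp [blockDiagonal'_apply_ne _ _ _ hk.symm]) (by simp)] at h
      simpa [Matrix.mulVec, dotProduct, blockDiagonal'_apply_eq, mul_comm] using h
    | zero => simp [← Pi.zero_def]
    | add x y _ _ hx hy =>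
      simp only [Pi.add_apply, map_add]
      exact (Matrix.mulVec_add _ _ _).trans (by rw [hx, hy, add_zero])
    | smul a x _ hx =>
      simp only [Pi.smul_apply, smul_eq_mul, map_mul]
      exact (Matrix.mulVec_smul _ (algebraMap Fq K a) _).trans (by rw [hx, smul_zero])
end

section
/- Suppose the length partition has constant block lengths n_i = η for all i, so n = ℓη. Then for every t ≥ 0: #{E ∈ F_{q^m}^{s×n} : srw(E) = t and rank_{q^m}(E) = t} · q^{smt} ≥ #{E ∈ F_{q^m}^{s×n} : srw(E) = t} · ∏_{j=0}^{t−1}(q^{sm} − q^{jm}). (Equivalently, for E drawn uniformly at random among the matrices of sum-rank weight t, the probability that rank_{q^m}(E) = t is at least ∏_{j=0}^{t−1}(1 − q^{m(j−s)}).) -/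
open Matrix Finset

/-- Sum-rank weight of `E ∈ F_{q^m}^{s×(ℓη)}` for constant block length `η`. -/
noncomputable def srw (Fq : Type) [Field Fq] {K : Type} [Field K] [Algebra Fq K]
    {s ℓ η : ℕ} (E : Matrix (Fin s) (Fin ℓ × Fin η) K) : ℕ :=
  ∑ i : Fin ℓ, Module.finrank Fq
    (Submodule.span Fq (Set.range fun j : Fin η => fun r : Fin s => E r (i, j)))

/-- The `F_q`-linear combinations of the columns of the `i`-th block of `E`. -/
noncomputable def blockMap (Fq : Type) [Field Fq] {K : Type} [Field K] [Algebra Fq K]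
    {s ℓ η : ℕ} (E : Matrix (Fin s) (Fin ℓ × Fin η) K) (i : Fin ℓ) :
    (Fin η → Fq) →ₗ[Fq] (Fin s → K) :=
  Fintype.linearCombination Fq fun j : Fin η => fun r : Fin s => E r (i, j)

section

variable {Fq : Type} [Field Fq] {K : Type} [Field K] [Algebra Fq K] {s ℓ η : ℕ}

theorem blockMap_single (E : Matrix (Fin s) (Fin ℓ × Fin η) K) (i : Fin ℓ) (j : Fin η) :
    blockMap Fq E i (Pi.single j 1) = fun r => E r (i, j) := by
  simp [blockMap, Fintype.linearCombination_apply_single]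

theorem blockMap_injective :
    Function.Injective (blockMap Fq : Matrix (Fin s) (Fin ℓ × Fin η) K → _) := by
  intro E E' h
  ext r ⟨i, j⟩
  have := congrFun ((blockMap_single (Fq := Fq) E i j).symm.trans
    (h ▸ blockMap_single (Fq := Fq) E' i j)) r
  exact this

theorem blockMap_of (f : Fin ℓ → (Fin η → Fq) →ₗ[Fq] (Fin s → K)) :
    blockMap Fq (Matrix.of fun r (p : Fin ℓ × Fin η) => f p.1 (Pi.single p.2 1) r) = f := by
  funext i
  refine LinearMap.pi_ext' fun j => LinearMap.ext_ring ?_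
  simp only [LinearMap.comp_apply, LinearMap.single_apply]
  rw [blockMap_single]
  rfl

theorem srw_eq_sum_finrank_quotient (E : Matrix (Fin s) (Fin ℓ × Fin η) K) :
    srw Fq E =
      ∑ i, Module.finrank Fq ((Fin η → Fq) ⧸ LinearMap.ker (blockMap Fq E i)) := by
  refine Finset.sum_congr rfl fun i _ => ?_
  rw [(blockMap Fq E i).quotKerEquivRange.finrank_eq, blockMap, Fintype.range_linearCombination]

theorem span_range_col_le_iff (E : Matrix (Fin s) (Fin ℓ × Fin η) K)
    (p : Submodule K (Fin s → K)) :
    Submodule.span K (Set.range E.col) ≤ p ↔ ∀ i x, blockMap Fq E i x ∈ p := by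
  rw [Submodule.span_le, Set.range_subset_iff]
  constructor
  · intro h i x
    rw [blockMap, Fintype.linearCombination_apply]
    exact Submodule.sum_mem _ fun j _ => p.smul_of_tower_mem _ (h (i, j))
  · rintro h ⟨i, j⟩
    have := h i (Pi.single j 1)
    rwa [blockMap_single] at this

/-- The linear maps on the quotients `F_q^η ⧸ W_i` that send the elements of their bases to the
vectors of the family `A`, as indexed by `e`. -/
noncomputable def liftFamily {t : ℕ} (W : Fin ℓ → Submodule Fq (Fin η → Fq))
    (e : (Σ i, Fin (Module.finrank Fq ((Fin η → Fq) ⧸ W i))) ≃ Fin t)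
    (A : Fin t → Fin s → K) (i : Fin ℓ) : ((Fin η → Fq) ⧸ W i) →ₗ[Fq] (Fin s → K) :=
  (Module.finBasis Fq ((Fin η → Fq) ⧸ W i)).constr Fq fun k => A (e ⟨i, k⟩)

variable {t : ℕ} (W : Fin ℓ → Submodule Fq (Fin η → Fq))
  (e : (Σ i, Fin (Module.finrank Fq ((Fin η → Fq) ⧸ W i))) ≃ Fin t)

theorem liftFamily_basis (A : Fin t → Fin s → K) (i : Fin ℓ)
    (k : Fin (Module.finrank Fq ((Fin η → Fq) ⧸ W i))) :
    liftFamily W e A i (Module.finBasis Fq ((Fin η → Fq) ⧸ W i) k) = A (e ⟨i, k⟩) := by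
  simp [liftFamily]

/-- The matrix whose block maps are the maps of `liftFamily`, precomposed with the quotient
maps. -/
noncomputable def liftMatrix (A : Fin t → Fin s → K) : Matrix (Fin s) (Fin ℓ × Fin η) K :=
  Matrix.of fun r p => (liftFamily W e A p.1 ∘ₗ (W p.1).mkQ) (Pi.single p.2 1) r

theorem blockMap_liftMatrix (A : Fin t → Fin s → K) (i : Fin ℓ) :
    blockMap Fq (liftMatrix W e A) i = liftFamily W e A i ∘ₗ (W i).mkQ :=
  congrFun (blockMap_of fun i => liftFamily W e A i ∘ₗ (W i).mkQ) i

theorem liftMatrix_injective :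
    Function.Injective (liftMatrix W e : (Fin t → Fin s → K) → _) := by
  intro A A' h
  funext x
  obtain ⟨⟨i, k⟩, rfl⟩ := e.surjective x
  rw [← liftFamily_basis W e A, ← liftFamily_basis W e A']
  obtain ⟨y, hy⟩ := (W i).mkQ_surjective (Module.finBasis Fq ((Fin η → Fq) ⧸ W i) k)
  have h' := (blockMap_liftMatrix W e A i).symm.trans (h ▸ blockMap_liftMatrix W e A' i)
  rw [← hy]
  exact LinearMap.congr_fun h' y

theorem exists_liftMatrix_eq (E : Matrix (Fin s) (Fin ℓ × Fin η) K)
    (hE : (fun i => LinearMap.ker (blockMap Fq E i)) = W) :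
    ∃ A, liftMatrix W e A = E := by
  have hW i : W i ≤ LinearMap.ker (blockMap Fq E i) := (congrFun hE i).ge
  refine ⟨fun x => (W (e.symm x).1).liftQ _ (hW _) (Module.finBasis Fq _ (e.symm x).2),
    blockMap_injective (Fq := Fq) (funext fun i => ?_)⟩
  rw [blockMap_liftMatrix]
  conv_rhs => rw [← (W i).liftQ_mkQ (blockMap Fq E i) (hW i)]
  congr 1
  refine (Module.finBasis Fq ((Fin η → Fq) ⧸ W i)).ext fun k => ?_
  rw [liftFamily_basis, e.symm_apply_apply]

theorem ker_blockMap_liftMatrix {A : Fin t → Fin s → K} (hA : LinearIndependent K A) :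
    (fun i => LinearMap.ker (blockMap Fq (liftMatrix W e A) i)) = W := by
  funext i
  have hi : LinearIndependent Fq fun k => A (e ⟨i, k⟩) :=
    (hA.restrict_scalars' Fq).comp (fun k => e ⟨i, k⟩)
      (e.injective.comp sigma_mk_injective)
  have hker : LinearMap.ker (liftFamily W e A i) = ⊥ := by
    refine LinearMap.ker_eq_bot.2 (LinearMap.injective_of_linearIndependent
      (Module.finBasis Fq ((Fin η → Fq) ⧸ W i)).span_eq ?_)
    simpa only [Function.comp_def, liftFamily_basis] using hi
  rw [blockMap_liftMatrix, LinearMap.ker_comp, hker, ← LinearMap.ker, Submodule.ker_mkQ]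

theorem rank_liftMatrix {A : Fin t → Fin s → K} (hA : LinearIndependent K A) :
    (liftMatrix W e A).rank = t := by
  have hspan : Submodule.span K (Set.range (liftMatrix W e A).col) =
      Submodule.span K (Set.range A) := by
    apply le_antisymm
    · rw [span_range_col_le_iff (Fq := Fq)]
      intro i x
      rw [blockMap_liftMatrix, LinearMap.comp_apply, liftFamily, Module.Basis.constr_apply_fintype]
      exact Submodule.sum_mem _ fun k _ => Submodule.smul_of_tower_mem _ _
        (Submodule.subset_span (Set.mem_range_self _))
    · rw [Submodule.span_le, Set.range_subset_iff]
      intro x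
      obtain ⟨⟨i, k⟩, rfl⟩ := e.surjective x
      obtain ⟨y, hy⟩ := (W i).mkQ_surjective (Module.finBasis Fq ((Fin η → Fq) ⧸ W i) k)
      have := (span_range_col_le_iff (Fq := Fq) (liftMatrix W e A) _).1 le_rfl i y
      rwa [blockMap_liftMatrix, LinearMap.comp_apply, hy, liftFamily_basis] at this
  rw [Matrix.rank_eq_finrank_span_cols, hspan, finrank_span_eq_card hA, Fintype.card_fin]

end

theorem card_mul_le_card_mul_of_fiberwise {X Y : Type*} [Finite X] [Finite Y] (f : X → Y)
    (P Q : X → Prop) (a b : ℕ)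
    (h : ∀ y, Nat.card {x // P x ∧ f x = y} * a ≤ Nat.card {x // Q x ∧ f x = y} * b) :
    Nat.card {x // P x} * a ≤ Nat.card {x // Q x} * b := by
  classical
  have := Fintype.ofFinite X
  have := Fintype.ofFinite Y
  have key (R : X → Prop) : Nat.card {x // R x} = ∑ y, Nat.card {x // R x ∧ f x = y} := by
    simp only [Nat.card_eq_fintype_card, Fintype.card_subtype]
    rw [Finset.card_eq_sum_card_fiberwise (f := f) (t := Finset.univ) (by simp)]
    simp only [Finset.filter_filter]
  rw [key P, key Q, Finset.sum_mul, Finset.sum_mul]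
  exact Finset.sum_le_sum fun y _ => h y

/-- For constant block lengths `η`, the number of matrices of sum-rank
weight `t` satisfying the full-rank condition, times `q^{smt}`, is at least the number of
matrices of sum-rank weight `t` times `∏_{j<t}(q^{sm} − q^{jm})`; i.e. for `E` uniform
among matrices of sum-rank weight `t`, `Pr[rank_{q^m}(E) = t] ≥ ∏_{j<t}(1 − q^{m(j−s)})`. -/
theorem stmt11 (q m s ℓ η t : ℕ) (Fq K : Type) [Field Fq] [Fintype Fq] [Field K] [Fintype K]
    [Algebra Fq K]
    (hq : Fintype.card Fq = q) (hK : Fintype.card K = q ^ m)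
    (hm : 1 ≤ m) (hs : 1 ≤ s) (hl : 1 ≤ ℓ) (hη : 1 ≤ η) :
    Nat.card {E : Matrix (Fin s) (Fin ℓ × Fin η) K // srw Fq E = t ∧ E.rank = t} *
        q ^ (s * m * t)
    ≥ Nat.card {E : Matrix (Fin s) (Fin ℓ × Fin η) K // srw Fq E = t} *
        ∏ j ∈ Finset.range t, (q ^ (s * m) - q ^ (j * m)) := by
  have hprod : ∏ j ∈ Finset.range t, (q ^ (s * m) - q ^ (j * m)) ≤
      Nat.card {A : Fin t → Fin s → K // LinearIndependent K A} := by
    rcases le_or_gt t s with hts | hts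
    · rw [card_linearIndependent (by simpa using hts), Finset.prod_range]
      simp [hK, ← pow_mul, mul_comm]
    · exact (Finset.prod_eq_zero (Finset.mem_range.2 hts)
        (Nat.sub_self (q ^ (s * m)))).trans_le
        (Nat.zero_le _)
  refine card_mul_le_card_mul_of_fiberwise
    (fun E i => LinearMap.ker (blockMap Fq E i)) _ _ _ _ fun W => ?_
  by_cases hW : ∑ i, Module.finrank Fq ((Fin η → Fq) ⧸ W i) = t
  · let e : (Σ i, Fin (Module.finrank Fq ((Fin η → Fq) ⧸ W i))) ≃ Fin t :=
      finSigmaFinEquiv.trans (finCongr hW)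
    have hle : Nat.card {E : Matrix (Fin s) (Fin ℓ × Fin η) K //
        srw Fq E = t ∧ (fun i => LinearMap.ker (blockMap Fq E i)) = W} ≤ q ^ (s * m * t) := by
      have hcard : q ^ (s * m * t) = Nat.card (Fin t → Fin s → K) := by
        simp [hK, ← pow_mul, mul_comm m s]
      rw [hcard]
      choose g hg using fun E : {E : Matrix (Fin s) (Fin ℓ × Fin η) K //
        srw Fq E = t ∧ (fun i => LinearMap.ker (blockMap Fq E i)) = W} =>
          exists_liftMatrix_eq W e E.1 E.2.2
      exact Nat.card_le_card_of_injective g fun E E' h =>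
        Subtype.ext ((hg E).symm.trans (h ▸ hg E'))
    have hge : Nat.card {A : Fin t → Fin s → K // LinearIndependent K A} ≤
        Nat.card {E : Matrix (Fin s) (Fin ℓ × Fin η) K //
          (srw Fq E = t ∧ E.rank = t) ∧ (fun i => LinearMap.ker (blockMap Fq E i)) = W} := by
      refine Nat.card_le_card_of_injective
        (fun A => ⟨liftMatrix W e A.1, ⟨?_, rank_liftMatrix W e A.2⟩,
          ker_blockMap_liftMatrix W e A.2⟩) fun A A' h =>
            Subtype.ext (liftMatrix_injective W e (congrArg Subtype.val h))
      have hker i := congrFun (ker_blockMap_liftMatrix W e A.2) i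
      rw [srw_eq_sum_finrank_quotient]
      exact (Finset.sum_congr rfl fun i _ => by rw [hker i]).trans hW
    rw [mul_comm]
    exact Nat.mul_le_mul (hprod.trans hge) hle
  · have : IsEmpty {E : Matrix (Fin s) (Fin ℓ × Fin η) K //
        srw Fq E = t ∧ (fun i => LinearMap.ker (blockMap Fq E i)) = W} := by
      refine ⟨fun ⟨E, hE, hEW⟩ => hW ?_⟩
      rw [← hE, srw_eq_sum_finrank_quotient, ← hEW]
    simp
end
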